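/- Let s > 0 be a real number, and let u, v ∈ F with ν(u) = 0 and ν(v) > 0; set X = [[0, u√ε],[v√ε, 0]] ∈ 𝔤. For k ∈ K we have k^{-1}·X·k ∈ X + 𝔨_s if and only if k = c·g for some c ∈ T(X) and g ∈ K_{⌈s⌉}. -/

import Mathlib

open Matrix

noncomputable section

/-- A 2×2 matrix over `E`. -/
abbrev Mat (E : Type) := Matrix (Fin 2) (Fin 2) E

/-- The context: `E/F` is the unramified quadratic extension of a finite extension `F` of
`ℚ_p` (`p` odd), encoded via the Galois involution `sig` (whose fixed field is `F`),
the valuation `nu` (normalized by `nu ϖ = 1` for a uniformizer `ϖ` of `F`),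
a square root `sqeps` of a non-square unit `eps = sqeps^2` of `O_F`, the residue-field
cardinality `q` of `F`, and an additive character `psi'` of `F` trivial on `p_F` and
nontrivial on `O_F`. -/
structure USetting (E : Type) [Field E] where
  sig : E →+* E
  nu : E → WithTop ℤ
  sqeps : E
  pi : E
  q : ℕ
  psi' : E → ℂ
  sig_invol : ∀ x, sig (sig x) = x
  sig_ne : ∃ x, sig x ≠ x
  nu_eq_top : ∀ x, nu x = ⊤ ↔ x = 0
  nu_mul : ∀ x y, nu (x * y) = nu x + nu y
  nu_add : ∀ x y, min (nu x) (nu y) ≤ nu (x + y)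
  nu_sig : ∀ x, nu (sig x) = nu x
  nu_pi : nu pi = 1
  sig_pi : sig pi = pi
  sig_sqeps : sig sqeps = - sqeps
  nu_sqeps : nu sqeps = 0
  eps_not_square : ∀ y, sig y = y → y * y ≠ sqeps * sqeps
  gen : ∀ x : E, ∃ a b, sig a = a ∧ sig b = b ∧ x = a + b * sqeps
  nu_two : nu 2 = 0
  charzero : ∀ n : ℕ, (n : E) = 0 → n = 0
  complete : ∀ f : ℕ → E, (∀ n : ℕ, ((n : ℤ) : WithTop ℤ) ≤ nu (f (n + 1) - f n)) →
    ∃ L, ∀ n : ℕ, ((n : ℤ) : WithTop ℤ) ≤ nu (L - f n)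
  res_card : ∃ R : Finset E, R.card = q ∧ (∀ x ∈ R, sig x = x ∧ 0 ≤ nu x) ∧
    ∀ y : E, sig y = y → 0 ≤ nu y → ∃! x, x ∈ R ∧ 1 ≤ nu (y - x)
  psi'_mul : ∀ x y, sig x = x → sig y = y → psi' (x + y) = psi' x * psi' y
  psi'_ne : ∀ x, sig x = x → psi' x ≠ 0
  psi'_triv : ∀ x, sig x = x → 1 ≤ nu x → psi' x = 1
  psi'_nontriv : ∃ x, sig x = x ∧ 0 ≤ nu x ∧ psi' x ≠ 1

variable {E : Type} [Field E]

/-- The matrix `w₀ = [[0,1],[1,0]]`. -/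
def w0 (E : Type) [Field E] : Mat E := !![0, 1; 1, 0]

/-- `G = U(1,1)(F)`. -/
def Gset (S : USetting E) : Set (Mat E) :=
  {g | (g.map ⇑S.sig)ᵀ * w0 E * g = w0 E}

/-- `K = G ∩ GL₂(O_E)`: entries in `O_E` and determinant in `O_E^×`. -/
def Kset (S : USetting E) : Set (Mat E) :=
  {g | g ∈ Gset S ∧ (∀ i j, 0 ≤ S.nu (g i j)) ∧ S.nu g.det = 0}

/-- The congruence filtration subgroup `K_n` (for `n ≥ 1`; `K_0 = K` as a set). -/
def Kfil (S : USetting E) (n : ℤ) : Set (Mat E) :=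
  {g | g ∈ Kset S ∧ ∀ i j, (n : WithTop ℤ) ≤ S.nu ((g - 1) i j)}

/-- `𝓑 = B ∩ K`, the upper triangular matrices in `K`. -/
def Bcal (S : USetting E) : Set (Mat E) := {g | g ∈ Kset S ∧ g 1 0 = 0}

/-- `E^1`, the norm-one elements of `E`. -/
def E1set (S : USetting E) : Set E := {x | x * S.sig x = 1}

/-- `O_F^×` as a subset of `E`. -/
def OFunits (S : USetting E) : Set E := {x | S.sig x = x ∧ S.nu x = 0}

/-- `O_E^×` as a subset of `E`. -/
def OEunits (S : USetting E) : Set E := {x | S.nu x = 0}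

/-- A character of `E^×`, encoded as a function `E → ℂ` multiplicative and
nonvanishing on nonzero elements. -/
def IsChar (χ : E → ℂ) : Prop :=
  (∀ x y : E, x ≠ 0 → y ≠ 0 → χ (x * y) = χ x * χ y) ∧ ∀ x : E, x ≠ 0 → χ x ≠ 0

/-- A group homomorphism `E^1 → ℂ^×`, encoded as a function `E → ℂ`. -/
def IsE1Hom (S : USetting E) (φ : E → ℂ) : Prop :=
  (∀ x ∈ E1set S, ∀ y ∈ E1set S, φ (x * y) = φ x * φ y) ∧ ∀ x ∈ E1set S, φ x ≠ 0

/-- A homomorphism into `ℂ^×` on a subset of matrices. -/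
def IsHomOn (A : Set (Mat E)) (Ψ : Mat E → ℂ) : Prop :=
  (∀ x ∈ A, ∀ y ∈ A, Ψ (x * y) = Ψ x * Ψ y) ∧ ∀ x ∈ A, Ψ x ≠ 0

/-- `1 + p_E^n`. -/
def onePE (S : USetting E) (n : ℤ) : Set E := {x | (n : WithTop ℤ) ≤ S.nu (x - 1)}

/-- `1 + p_F^n`. -/
def onePF (S : USetting E) (n : ℤ) : Set E :=
  {x | S.sig x = x ∧ (n : WithTop ℤ) ≤ S.nu (x - 1)}

/-- `χ` is trivial on a set. -/
def TrivOn (χ : E → ℂ) (s : Set E) : Prop := ∀ x ∈ s, χ x = 1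

/-- `χ` has depth `r`: trivial on `1+p_E^{r+1}` and (if `r ≥ 1`) nontrivial on `1+p_E^r`. -/
def HasDepth (S : USetting E) (χ : E → ℂ) (r : ℕ) : Prop :=
  TrivOn χ (onePE S ((r : ℤ) + 1)) ∧ (r = 0 ∨ ¬ TrivOn χ (onePE S (r : ℤ)))

/-- `χ` has true depth `r`: the depth of its restriction to `F^×` is `r`. -/
def HasTrueDepth (S : USetting E) (χ : E → ℂ) (r : ℕ) : Prop :=
  TrivOn χ (onePF S ((r : ℤ) + 1)) ∧ (r = 0 ∨ ¬ TrivOn χ (onePF S (r : ℤ)))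

/-- `χ` has minimal depth `r`: its depth and true depth both equal `r`. -/
def MinDepth (S : USetting E) (χ : E → ℂ) (r : ℕ) : Prop :=
  HasDepth S χ r ∧ HasTrueDepth S χ r

/-- Right translation action on functions. -/
def rho (g : Mat E) : (Mat E → ℂ) →ₗ[ℂ] (Mat E → ℂ) where
  toFun f := fun k => f (k * g)
  map_add' _ _ := rfl
  map_smul' _ _ := rfl

/-- The space `V_χ^{K_n}`: functions on `K` (extended by zero off `K`) satisfying
`f(bk) = χ(b₁₁) f(k)` for `b ∈ 𝓑` and right `K_n`-invariance. -/
def Vsp (S : USetting E) (χ : E → ℂ) (n : ℤ) : Submodule ℂ (Mat E → ℂ) where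
  carrier := {f | (∀ x, x ∉ Kset S → f x = 0) ∧
    (∀ b ∈ Bcal S, ∀ k ∈ Kset S, f (b * k) = χ (b 0 0) * f k) ∧
    (∀ k ∈ Kset S, ∀ g ∈ Kfil S n, f (k * g) = f k)}
  add_mem' := by
    rintro f g ⟨hf0, hf1, hf2⟩ ⟨hg0, hg1, hg2⟩
    refine ⟨fun x hx => ?_, fun b hb k hk => ?_, fun k hk g' hg' => ?_⟩
    · simp [hf0 x hx, hg0 x hx]
    · simp only [Pi.add_apply, hf1 b hb k hk, hg1 b hb k hk]; ring
    · simp only [Pi.add_apply, hf2 k hk g' hg', hg2 k hk g' hg']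
  zero_mem' := by
    refine ⟨fun x _ => rfl, fun b _ k _ => by simp, fun k _ g _ => rfl⟩
  smul_mem' := by
    rintro c f ⟨hf0, hf1, hf2⟩
    refine ⟨fun x hx => ?_, fun b hb k hk => ?_, fun k hk g' hg' => ?_⟩
    · simp [hf0 x hx]
    · simp only [Pi.smul_apply, hf1 b hb k hk, smul_eq_mul]; ring
    · simp only [Pi.smul_apply, hf2 k hk g' hg']

/-- The space of the representation induced from a character `Ψ` of a subgroup `H ⊆ K`:
functions on `K` (extended by zero) with `f(hk) = Ψ(h) f(k)`. -/
def IndSp (S : USetting E) (H : Set (Mat E)) (Ψ : Mat E → ℂ) : Submodule ℂ (Mat E → ℂ) where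
  carrier := {f | (∀ x, x ∉ Kset S → f x = 0) ∧
    ∀ h ∈ H, ∀ k ∈ Kset S, f (h * k) = Ψ h * f k}
  add_mem' := by
    rintro f g ⟨hf0, hf1⟩ ⟨hg0, hg1⟩
    refine ⟨fun x hx => ?_, fun h hh k hk => ?_⟩
    · simp [hf0 x hx, hg0 x hx]
    · simp only [Pi.add_apply, hf1 h hh k hk, hg1 h hh k hk]; ring
  zero_mem' := ⟨fun x _ => rfl, fun h _ k _ => by simp⟩
  smul_mem' := by
    rintro c f ⟨hf0, hf1⟩
    refine ⟨fun x hx => ?_, fun h hh k hk => ?_⟩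
    · simp [hf0 x hx]
    · simp only [Pi.smul_apply, hf1 h hh k hk, smul_eq_mul]; ring

/-- The functions constant on `K` and zero off `K`. -/
def ConstSub (S : USetting E) : Submodule ℂ (Mat E → ℂ) where
  carrier := {f | (∀ x, x ∉ Kset S → f x = 0) ∧ ∃ c : ℂ, ∀ k ∈ Kset S, f k = c}
  add_mem' := by
    rintro f g ⟨hf0, c, hc⟩ ⟨hg0, c', hc'⟩
    exact ⟨fun x hx => by simp [hf0 x hx, hg0 x hx],
      c + c', fun k hk => by simp [hc k hk, hc' k hk]⟩
  zero_mem' := ⟨fun x _ => rfl, 0, fun _ _ => rfl⟩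
  smul_mem' := by
    rintro a f ⟨hf0, c, hc⟩
    exact ⟨fun x hx => by simp [hf0 x hx], a * c, fun k hk => by simp [hc k hk]⟩

/-- A subspace is `K`-invariant. -/
def KInvariant (S : USetting E) (W : Submodule ℂ (Mat E → ℂ)) : Prop :=
  ∀ g ∈ Kset S, ∀ f ∈ W, rho g f ∈ W

/-- A subset `A ⊆ K` acts trivially on `W`. -/
def ActsTrivially (S : USetting E) (A : Set (Mat E)) (W : Submodule ℂ (Mat E → ℂ)) : Prop :=
  ∀ g ∈ A, ∀ f ∈ W, rho g f = f

/-- `W` is an irreducible representation of `K`. -/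
def IsIrredRep (S : USetting E) (W : Submodule ℂ (Mat E → ℂ)) : Prop :=
  W ≠ ⊥ ∧ KInvariant S W ∧
    ∀ U : Submodule ℂ (Mat E → ℂ), U ≤ W → KInvariant S U → U = ⊥ ∨ U = W

/-- `V` and `W` are isomorphic as representations of `K`. -/
def RepIso (S : USetting E) (V W : Submodule ℂ (Mat E → ℂ)) : Prop :=
  ∃ e : (Mat E → ℂ) →ₗ[ℂ] (Mat E → ℂ), Set.BijOn ⇑e ↑V ↑W ∧
    ∀ g ∈ Kset S, ∀ f ∈ V, e (rho g f) = rho g (e f)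

/-- The space of `ℂ`-linear endomorphisms of `V` commuting with the right-translation
action of `K`, realized inside the function space `↥V → ↥V`. -/
def Commutant (S : USetting E) (V : Submodule ℂ (Mat E → ℂ)) :
    Submodule ℂ (↥V → ↥V) where
  carrier := {T | (∀ x y : ↥V, T (x + y) = T x + T y) ∧
    (∀ (c : ℂ) (x : ↥V), T (c • x) = c • T x) ∧
    ∀ g ∈ Kset S, ∀ f : ↥V, ∀ h : rho g (f : Mat E → ℂ) ∈ V,
      ((T ⟨rho g (f : Mat E → ℂ), h⟩ : ↥V) : Mat E → ℂ) = rho g ((T f : ↥V) : Mat E → ℂ)}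
  add_mem' := by
    rintro T T' ⟨hT1, hT2, hT3⟩ ⟨hT1', hT2', hT3'⟩
    refine ⟨fun x y => ?_, fun c x => ?_, fun g hg f h => ?_⟩
    · simp only [Pi.add_apply, hT1 x y, hT1' x y]; abel
    · simp only [Pi.add_apply, hT2 c x, hT2' c x, smul_add]
    · simp only [Pi.add_apply, Submodule.coe_add, hT3 g hg f h, hT3' g hg f h, map_add]
  zero_mem' := by
    refine ⟨fun x y => by simp, fun c x => by simp, fun g hg f h => by simp⟩
  smul_mem' := by
    rintro c T ⟨hT1, hT2, hT3⟩
    refine ⟨fun x y => ?_, fun a x => ?_, fun g hg f h => ?_⟩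
    · simp only [Pi.smul_apply, hT1 x y, smul_add]
    · simp only [Pi.smul_apply, hT2 a x, smul_comm c a]
    · simp only [Pi.smul_apply, Submodule.coe_smul, hT3 g hg f h, _root_.map_smul]

/-- The additive character `ψ` of `E`, `ψ(x) = ψ'((x + σ(x))/2)`. -/
def psiE (S : USetting E) (x : E) : ℂ := S.psi' ((x + S.sig x) / 2)

/-- `Ψ_Y(g) = ψ(Tr(Y (g − 1)))`. -/
def PsiC (S : USetting E) (Y g : Mat E) : ℂ := psiE S ((Y * (g - 1)).trace)

/-- The Lie algebra `𝔤 = 𝔲(1,1)(F)`. -/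
def gfrak (S : USetting E) : Set (Mat E) :=
  {Y | (Y.map ⇑S.sig)ᵀ * w0 E + w0 E * Y = 0}

/-- The lattice `𝔨_s` of the Lie algebra, where `c = ⌈s⌉`. -/
def kfrakC (S : USetting E) (c : ℤ) : Set (Mat E) :=
  {Y | Y ∈ gfrak S ∧ (c : WithTop ℤ) ≤ S.nu (Y 0 0) ∧ (c : WithTop ℤ) ≤ S.nu (Y 1 1) ∧
    (∃ t, S.sig t = t ∧ (c : WithTop ℤ) ≤ S.nu t ∧ Y 0 1 = S.sqeps * t) ∧
    (∃ t, S.sig t = t ∧ (c : WithTop ℤ) ≤ S.nu t ∧ Y 1 0 = S.sqeps * t)}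

/-- The group `J_d`. -/
def Jgrp (S : USetting E) (d : ℕ) : Set (Mat E) :=
  {g | g ∈ Kset S ∧ ((((d + 1) / 2 : ℕ) : WithTop ℤ) ≤ S.nu (g 0 0 - 1)) ∧
    ((((d + 1) / 2 : ℕ) : WithTop ℤ) ≤ S.nu (g 0 1)) ∧
    ((((d + 1) / 2 : ℕ) : WithTop ℤ) ≤ S.nu (g 1 1 - 1)) ∧
    (((d / 2 + 1 : ℕ) : WithTop ℤ) ≤ S.nu (g 1 0))}

/-- The centralizer `T(X)` in `K` of `X = [[z√ε, u√ε],[v√ε, z√ε]]`. -/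
def TXset (S : USetting E) (u v : E) : Set (Mat E) :=
  {m | m ∈ Kset S ∧ m 1 1 = m 0 0 ∧ m 1 0 = m 0 1 * (u⁻¹ * v)}

/-- The center `Z` of `G`, identified with scalar matrices with entries in `E^1`. -/
def Zset (S : USetting E) : Set (Mat E) := {m | ∃ z ∈ E1set S, m = z • (1 : Mat E)}

/-- `𝒰 = U ∩ K`. -/
def Uset (S : USetting E) : Set (Mat E) :=
  {m | ∃ b, S.sig b = b ∧ 0 ≤ S.nu b ∧ m = !![1, b * S.sqeps; 0, 1]}

/-- The set of products `T(X)·J_d`. -/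
def TXJ (S : USetting E) (u v : E) (d : ℕ) : Set (Mat E) :=
  {x | ∃ t ∈ TXset S u v, ∃ j ∈ Jgrp S d, x = t * j}

/-- The set of products `Z·𝒰·J_d`. -/
def ZUJ (S : USetting E) (d : ℕ) : Set (Mat E) :=
  {x | ∃ z ∈ Zset S, ∃ m ∈ Uset S, ∃ j ∈ Jgrp S d, x = z * m * j}

/-- `X = [[z√ε, u√ε],[v√ε, z√ε]]`. -/
def Xzuv (S : USetting E) (z u v : E) : Mat E :=
  !![z * S.sqeps, u * S.sqeps; v * S.sqeps, z * S.sqeps]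

/-- The nilpotent element `X_δ = [[0, δ√ε],[0,0]]`. -/
def Xdelta (S : USetting E) (δ : E) : Mat E := !![0, δ * S.sqeps; 0, 0]

/-- `W` is a `K`-invariant complement of `V_χ^{K_d}` inside `V_χ^{K_{d+1}}`. -/
def Wcompl (S : USetting E) (χ : E → ℂ) (d : ℕ) (W : Submodule ℂ (Mat E → ℂ)) : Prop :=
  W ≤ Vsp S χ ((d : ℤ) + 1) ∧ KInvariant S W ∧
    Vsp S χ (d : ℤ) ⊓ W = ⊥ ∧ Vsp S χ (d : ℤ) ⊔ W = Vsp S χ ((d : ℤ) + 1)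

namespace USetting

variable (S : USetting E)

lemma nu_zero : S.nu 0 = ⊤ := (S.nu_eq_top 0).2 rfl

lemma nu_one : S.nu 1 = 0 := by
  have h := S.nu_mul 1 1
  rw [mul_one] at h
  have hne : S.nu 1 ≠ ⊤ := fun h => one_ne_zero ((S.nu_eq_top 1).1 h)
  lift S.nu 1 to ℤ using hne with m
  norm_cast at h ⊢
  omega

/-- The valuation `ν` as a Mathlib additive valuation. -/
def addVal : AddValuation E (WithTop ℤ) :=
  AddValuation.of S.nu S.nu_zero S.nu_one S.nu_add S.nu_mul

lemma nu_neg (x : E) : S.nu (-x) = S.nu x := S.addVal.map_neg x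

variable {S}

lemma le_nu_add {g : WithTop ℤ} {x y : E} (hx : g ≤ S.nu x) (hy : g ≤ S.nu y) :
    g ≤ S.nu (x + y) := S.addVal.map_le_add hx hy

lemma le_nu_sub {g : WithTop ℤ} {x y : E} (hx : g ≤ S.nu x) (hy : g ≤ S.nu y) :
    g ≤ S.nu (x - y) := S.addVal.map_le_sub hx hy

lemma le_nu_neg {g : WithTop ℤ} {x : E} (hx : g ≤ S.nu x) : g ≤ S.nu (-x) := by
  rwa [S.nu_neg]

lemma le_nu_sub_comm {g : WithTop ℤ} {x y : E} (h : g ≤ S.nu (x - y)) : g ≤ S.nu (y - x) := by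
  rw [← neg_sub]; exact le_nu_neg h

lemma le_nu_mul_right {g : WithTop ℤ} {x y : E} (hx : g ≤ S.nu x) (hy : 0 ≤ S.nu y) :
    g ≤ S.nu (x * y) := by
  rw [S.nu_mul]; simpa using add_le_add hx hy

lemma le_nu_mul_left {g : WithTop ℤ} {x y : E} (hx : 0 ≤ S.nu x) (hy : g ≤ S.nu y) :
    g ≤ S.nu (x * y) := by
  rw [mul_comm]; exact le_nu_mul_right hy hx

lemma le_nu_sig {g : WithTop ℤ} {x : E} (hx : g ≤ S.nu x) : g ≤ S.nu (S.sig x) := by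
  rwa [S.nu_sig]

lemma ne_zero_of_nu_eq_zero {x : E} (hx : S.nu x = 0) : x ≠ 0 := by
  rintro rfl
  rw [S.nu_zero] at hx
  exact WithTop.top_ne_zero hx

lemma nu_inv_of_nu_eq_zero {x : E} (hx : S.nu x = 0) : S.nu x⁻¹ = 0 := by
  have h := S.nu_mul x x⁻¹
  rw [mul_inv_cancel₀ (ne_zero_of_nu_eq_zero hx), hx, S.nu_one, zero_add] at h
  exact h.symm

lemma le_nu_of_le_nu_mul_left {g : WithTop ℤ} {x y : E} (hx : S.nu x = 0)
    (h : g ≤ S.nu (x * y)) : g ≤ S.nu y := by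
  rwa [S.nu_mul, hx, zero_add] at h

lemma eq_zero_of_forall_le_nu {x : E} (h : ∀ m : ℕ, ((m : ℤ) : WithTop ℤ) ≤ S.nu x) :
    x = 0 := by
  rw [← S.nu_eq_top]
  by_contra hne
  lift S.nu x to ℤ using hne with j
  have := h (j.toNat + 1)
  norm_cast at this
  omega

lemma nu_eq_zero_of_one_le_nu_sub_one {x : E} (h : 1 ≤ S.nu (x - 1)) : S.nu x = 0 := by
  have h2 := S.addVal.map_eq_of_lt_sub (x := 1) (y := x) (by
    change S.nu 1 < S.nu (x - 1)
    rw [S.nu_one]; exact lt_of_lt_of_le zero_lt_one h)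
  exact h2.trans S.nu_one

/-- Square roots of one-units of `F` exist in `F`, at the same congruence level. -/
lemma exists_sq_eq {n : ℤ} (hn : 1 ≤ n) {D : E} (hD : S.sig D = D)
    (hDn : (n : WithTop ℤ) ≤ S.nu (D - 1)) :
    ∃ r, S.sig r = r ∧ r * r = D ∧ (n : WithTop ℤ) ≤ S.nu (r - 1) := by
  have h2inv : S.nu (2⁻¹ : E) = 0 := nu_inv_of_nu_eq_zero S.nu_two
  have h2 : (2 : E) ≠ 0 := ne_zero_of_nu_eq_zero S.nu_two
  let f : ℕ → E := fun m => Nat.rec 1 (fun _ x => x - (x * x - D) * 2⁻¹) m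
  have hf0 : f 0 = 1 := rfl
  have hfs (m : ℕ) : f (m + 1) = f m - (f m * f m - D) * 2⁻¹ := rfl
  have key (m : ℕ) : S.sig (f m) = f m ∧ (n : WithTop ℤ) ≤ S.nu (f m - 1) ∧
      ((n + m : ℤ) : WithTop ℤ) ≤ S.nu (f m * f m - D) := by
    induction m with
    | zero =>
      refine ⟨by simp [hf0], by simp [hf0, S.nu_zero], ?_⟩
      simpa [hf0] using le_nu_sub_comm hDn
    | succ m ih =>
      obtain ⟨h1, h3, h4⟩ := ih
      have h4n : (n : WithTop ℤ) ≤ S.nu (f m * f m - D) :=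
        le_trans (by exact_mod_cast (by omega : n ≤ n + m)) h4
      rw [hfs]
      refine ⟨by simp [h1, hD, map_ofNat], ?_, ?_⟩
      · rw [sub_right_comm]
        exact le_nu_sub h3 (le_nu_mul_right h4n h2inv.ge)
      · have e : (f m - (f m * f m - D) * 2⁻¹) * (f m - (f m * f m - D) * 2⁻¹) - D
            = (f m * f m - D) * ((f m * f m - D) * (2⁻¹ * 2⁻¹) - (f m - 1)) := by
          field_simp; ring
        rw [e, S.nu_mul]
        have h5 : (n : WithTop ℤ) ≤ S.nu ((f m * f m - D) * (2⁻¹ * 2⁻¹) - (f m - 1)) :=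
          le_nu_sub (le_nu_mul_right h4n (le_nu_mul_right h2inv.ge h2inv.ge)) h3
        refine le_trans ?_ (add_le_add h4 h5)
        norm_cast
        push_cast
        omega
  have hle (m : ℕ) : ((m : ℤ) : WithTop ℤ) ≤ ((n + m : ℤ) : WithTop ℤ) := by
    exact_mod_cast (by omega : (m : ℤ) ≤ n + m)
  obtain ⟨L, hL⟩ := S.complete f fun m => by
    rw [hfs, sub_sub_cancel_left]
    exact le_nu_neg (le_nu_mul_right ((hle m).trans (key m).2.2) h2inv.ge)
  have hn0 : (0 : WithTop ℤ) ≤ (n : WithTop ℤ) := by exact_mod_cast (by omega : 0 ≤ n)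
  have hLn : (n : WithTop ℤ) ≤ S.nu (L - 1) := by
    have h := hL n.toNat
    rw [Int.toNat_of_nonneg (by omega)] at h
    simpa using le_nu_add h (key n.toNat).2.1
  have hint {x : E} (hx : (n : WithTop ℤ) ≤ S.nu (x - 1)) : 0 ≤ S.nu x := by
    simpa using le_nu_add (hn0.trans hx) S.nu_one.ge
  refine ⟨L, ?_, ?_, hLn⟩
  · refine sub_eq_zero.1 (eq_zero_of_forall_le_nu (S := S) fun m => ?_)
    have h := le_nu_sub (le_nu_sig (hL m)) (hL m)
    rwa [map_sub, (key m).1, sub_sub_sub_cancel_right] at h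
  · refine sub_eq_zero.1 (eq_zero_of_forall_le_nu (S := S) fun m => ?_)
    have e : L * L - D = (L - f m) * (L + f m) + (f m * f m - D) := by ring
    rw [e]
    exact le_nu_add (le_nu_mul_right (hL m) (le_nu_add (hint hLn) (hint (key m).2.1)))
      ((hle m).trans (key m).2.2)

end USetting

open USetting

lemma le_nu_matrix_mul {S : USetting E} {g : WithTop ℤ} {A B : Mat E}
    (hA : ∀ i j, 0 ≤ S.nu (A i j)) (hB : ∀ i j, g ≤ S.nu (B i j)) (i j : Fin 2) :
    g ≤ S.nu ((A * B) i j) := by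
  rw [Matrix.mul_apply, Fin.sum_univ_two]
  exact le_nu_add (le_nu_mul_left (hA _ _) (hB _ _)) (le_nu_mul_left (hA _ _) (hB _ _))

lemma w0_mul_w0 : w0 E * w0 E = 1 := by
  ext i j; fin_cases i <;> fin_cases j <;> simp [w0]

/-- The adjoint map `g ↦ w₀ σ(g)ᵀ w₀` of the Hermitian form. -/
def herm (S : USetting E) (g : Mat E) : Mat E := w0 E * (g.map ⇑S.sig)ᵀ * w0 E

lemma herm_apply (S : USetting E) (g : Mat E) :
    herm S g = !![S.sig (g 1 1), S.sig (g 0 1); S.sig (g 1 0), S.sig (g 0 0)] := by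
  ext i j
  fin_cases i <;> fin_cases j <;>
    simp [herm, w0, Matrix.mul_apply, Matrix.vecMul, dotProduct, Fin.sum_univ_two]

lemma herm_mul (S : USetting E) (g h : Mat E) : herm S (g * h) = herm S h * herm S g := by
  have e : w0 E * w0 E = 1 := w0_mul_w0
  simp only [herm, Matrix.map_mul, Matrix.transpose_mul]
  calc w0 E * ((h.map S.sig)ᵀ * (g.map S.sig)ᵀ) * w0 E
      = w0 E * (h.map S.sig)ᵀ * 1 * (g.map S.sig)ᵀ * w0 E := by simp only [mul_one, mul_assoc]
    _ = _ := by rw [← e]; simp only [mul_assoc]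

lemma herm_sub (S : USetting E) (g h : Mat E) : herm S (g - h) = herm S g - herm S h := by
  ext i j; fin_cases i <;> fin_cases j <;> simp [herm_apply]

lemma herm_herm (S : USetting E) (g : Mat E) : herm S (herm S g) = g := by
  ext i j; fin_cases i <;> fin_cases j <;> simp [herm_apply, S.sig_invol]

lemma mem_Gset_iff {S : USetting E} {g : Mat E} : g ∈ Gset S ↔ herm S g * g = 1 := by
  have e : w0 E * w0 E = 1 := w0_mul_w0
  constructor
  · intro h
    change _ = _ at h
    rw [herm, mul_assoc, mul_assoc, ← mul_assoc _ (w0 E), h, e]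
  · intro h
    change _ = _
    calc (g.map S.sig)ᵀ * w0 E * g = w0 E * w0 E * (g.map S.sig)ᵀ * w0 E * g := by
          rw [e, one_mul]
      _ = w0 E * (herm S g * g) := by simp only [herm, mul_assoc]
      _ = w0 E := by rw [h, mul_one]

lemma mem_gfrak_iff {S : USetting E} {Y : Mat E} : Y ∈ gfrak S ↔ herm S Y = -Y := by
  have e : w0 E * w0 E = 1 := w0_mul_w0
  constructor
  · intro h
    change _ = _ at h
    rw [herm, mul_assoc, eq_neg_of_add_eq_zero_left h, mul_neg, ← mul_assoc, e, one_mul]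
  · intro h
    change _ = _
    have : (Y.map S.sig)ᵀ * w0 E = w0 E * herm S Y := by
      rw [herm, mul_assoc (w0 E), ← mul_assoc (w0 E) (w0 E), e, one_mul]
    rw [this, h, mul_neg, neg_add_cancel]

lemma inv_eq_herm {S : USetting E} {g : Mat E} (hg : g ∈ Gset S) : g⁻¹ = herm S g :=
  Matrix.inv_eq_left_inv (mem_Gset_iff.1 hg)

lemma herm_mem_Gset {S : USetting E} {g : Mat E} (hg : g ∈ Gset S) : herm S g ∈ Gset S := by
  rw [mem_Gset_iff, herm_herm]
  exact mul_eq_one_comm.1 (mem_Gset_iff.1 hg)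

lemma mul_mem_Gset {S : USetting E} {g h : Mat E} (hg : g ∈ Gset S) (hh : h ∈ Gset S) :
    g * h ∈ Gset S := by
  rw [mem_Gset_iff] at *
  rw [herm_mul, mul_assoc, ← mul_assoc _ g, hg, one_mul, hh]

lemma le_nu_herm {S : USetting E} {n : WithTop ℤ} {g : Mat E} (hg : ∀ i j, n ≤ S.nu (g i j))
    (i j : Fin 2) : n ≤ S.nu (herm S g i j) := by
  rw [herm_apply]
  fin_cases i <;> fin_cases j <;> simpa [S.nu_sig] using hg _ _

/-- Elements of `G` with integral entries lie in `K`. -/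
lemma mem_Kset_of_integral {S : USetting E} {g : Mat E} (hg : g ∈ Gset S)
    (hi : ∀ i j, 0 ≤ S.nu (g i j)) : g ∈ Kset S := by
  refine ⟨hg, hi, ?_⟩
  have hint {A : Mat E} (hA : ∀ i j, 0 ≤ S.nu (A i j)) : 0 ≤ S.nu A.det := by
    rw [Matrix.det_fin_two]
    exact le_nu_sub (le_nu_mul_left (hA _ _) (hA _ _)) (le_nu_mul_left (hA _ _) (hA _ _))
  have h := congrArg (fun A : Mat E => S.nu A.det) (mem_Gset_iff.1 hg)
  simp only [Matrix.det_mul, Matrix.det_one, S.nu_mul, S.nu_one] at h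
  refine le_antisymm ?_ (hint hi)
  rw [← h]
  exact le_add_of_nonneg_left (hint (le_nu_herm hi))

/-- Elements of `𝔤` with entries of valuation at least `n` lie in the lattice of level `n`. -/
lemma mem_kfrakC_of_le {S : USetting E} {n : ℤ} {Y : Mat E} (hY : Y ∈ gfrak S)
    (hn : ∀ i j, (n : WithTop ℤ) ≤ S.nu (Y i j)) : Y ∈ kfrakC S n := by
  have hs : S.sqeps ≠ 0 := ne_zero_of_nu_eq_zero S.nu_sqeps
  have h := mem_gfrak_iff.1 hY
  rw [herm_apply] at h
  have h01 : S.sig (Y 0 1) = -Y 0 1 := by simpa using congrFun (congrFun h 0) 1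
  have h10 : S.sig (Y 1 0) = -Y 1 0 := by simpa using congrFun (congrFun h 1) 0
  have aux {y : E} (hy : S.sig y = -y) (hyn : (n : WithTop ℤ) ≤ S.nu y) :
      ∃ t, S.sig t = t ∧ (n : WithTop ℤ) ≤ S.nu t ∧ y = S.sqeps * t :=
    ⟨S.sqeps⁻¹ * y, by rw [map_mul, map_inv₀, S.sig_sqeps, hy]; field_simp,
      le_nu_mul_left (nu_inv_of_nu_eq_zero S.nu_sqeps).ge hyn, by field_simp⟩
  exact ⟨hY, hn _ _, hn _ _, aux h01 (hn _ _), aux h10 (hn _ _)⟩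

lemma le_nu_of_mem_kfrakC {S : USetting E} {n : ℤ} {Y : Mat E} (hY : Y ∈ kfrakC S n)
    (i j : Fin 2) : (n : WithTop ℤ) ≤ S.nu (Y i j) := by
  obtain ⟨-, h00, h11, ⟨t, -, ht, h01⟩, ⟨t', -, ht', h10⟩⟩ := hY
  fin_cases i <;> fin_cases j
  · exact h00
  · change _ ≤ S.nu (Y 0 1)
    rw [h01]; exact le_nu_mul_left S.nu_sqeps.ge ht
  · change _ ≤ S.nu (Y 1 0)
    rw [h10]; exact le_nu_mul_left S.nu_sqeps.ge ht'
  · exact h11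

lemma Xzuv_mem_gfrak {S : USetting E} {u v : E} (hu : S.sig u = u) (hv : S.sig v = v) :
    Xzuv S 0 u v ∈ gfrak S := by
  rw [mem_gfrak_iff, herm_apply]
  ext i j; fin_cases i <;> fin_cases j <;> simp [Xzuv, hu, hv, S.sig_sqeps]

lemma conj_sub_mem_gfrak {S : USetting E} {g X : Mat E} (hg : g ∈ Gset S) (hX : X ∈ gfrak S) :
    g⁻¹ * X * g - X ∈ gfrak S := by
  rw [mem_gfrak_iff] at *
  rw [inv_eq_herm hg, herm_sub, herm_mul, herm_mul, herm_herm, hX]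
  simp only [mul_neg, neg_mul, mul_assoc, neg_sub]
  abel

/-- Elements of `T(X)` commute with `X`. -/
lemma commute_Xzuv_of_mem_TXset {S : USetting E} {u v : E} (hu : u ≠ 0) {c : Mat E}
    (hc : c ∈ TXset S u v) : Xzuv S 0 u v * c = c * Xzuv S 0 u v := by
  obtain ⟨-, h11, h10⟩ := hc
  ext i j
  fin_cases i <;> fin_cases j <;>
    simp [Xzuv, Matrix.mul_apply, Fin.sum_univ_two, h11, h10] <;> field_simp

/-- An element of `K` commuting with `X` up to level `n` is congruent at level `n` to an element
of the centralizer `T(X)`. -/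
lemma exists_mem_TXset_sub_le {S : USetting E} {n : ℤ} (hn : 1 ≤ n) {u v : E}
    (hu : S.sig u = u) (hv : S.sig v = v) (hnu : S.nu u = 0) (hnv : 0 < S.nu v)
    {k : Mat E} (hk : k ∈ Kset S) (hd : (n : WithTop ℤ) ≤ S.nu (k 1 1 - k 0 0))
    (hc : (n : WithTop ℤ) ≤ S.nu (k 1 0 - k 0 1 * (u⁻¹ * v))) :
    ∃ t ∈ TXset S u v, ∀ i j, (n : WithTop ℤ) ≤ S.nu ((k - t) i j) := by
  obtain ⟨hG, hi, -⟩ := hk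
  have hH := mem_Gset_iff.1 hG
  rw [herm_apply] at hH
  have e00 : S.sig (k 1 1) * k 0 0 + S.sig (k 0 1) * k 1 0 = 1 := by
    simpa [Matrix.mul_apply, Fin.sum_univ_two] using congrFun (congrFun hH 0) 0
  have e01 : S.sig (k 1 1) * k 0 1 + S.sig (k 0 1) * k 1 1 = 0 := by
    simpa [Matrix.mul_apply, Fin.sum_univ_two] using congrFun (congrFun hH 0) 1
  set w := u⁻¹ * v with hw
  have hsw : S.sig w = w := by simp [hw, hu, hv]
  have hnw : 1 ≤ S.nu w := by
    rw [hw, S.nu_mul, nu_inv_of_nu_eq_zero hnu, zero_add]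
    rcases eq_or_ne (S.nu v) ⊤ with h | h
    · simp [h]
    · lift S.nu v to ℤ using h with m
      norm_cast at hnv ⊢
  have hnw0 : 0 ≤ S.nu w := zero_le_one.trans hnw
  have hn1 : (1 : WithTop ℤ) ≤ (n : WithTop ℤ) := by exact_mod_cast hn
  have ha0 := hi 0 0
  have hb0 := hi 0 1
  have hd0 := hi 1 1
  obtain ⟨a, ha⟩ : ∃ a, a = k 0 0 := ⟨_, rfl⟩
  obtain ⟨b, hb⟩ : ∃ b, b = k 0 1 := ⟨_, rfl⟩
  obtain ⟨c, hc'⟩ : ∃ c, c = k 1 0 := ⟨_, rfl⟩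
  obtain ⟨d, hd'⟩ : ∃ d, d = k 1 1 := ⟨_, rfl⟩
  rw [← ha, ← hd'] at hd
  rw [← hb, ← hc'] at hc
  rw [← ha, ← hb, ← hc', ← hd'] at e00
  rw [← hb, ← hd'] at e01
  rw [← ha] at ha0
  rw [← hb] at hb0
  rw [← hd'] at hd0
  -- the diagonal entries are units
  have hc1 : 1 ≤ S.nu c := by
    simpa using le_nu_add (hn1.trans hc) (le_nu_mul_left hb0 hnw)
  have hda : S.nu (S.sig d * a) = 0 := by
    refine nu_eq_zero_of_one_le_nu_sub_one ?_
    rw [← e00, sub_add_cancel_left]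
    exact le_nu_neg (le_nu_mul_left (le_nu_sig hb0) hc1)
  have hau : S.nu a = 0 := by
    refine le_antisymm ?_ ha0
    rw [← hda, S.nu_mul]
    exact le_add_of_nonneg_left (le_nu_sig hd0)
  have hane : a ≠ 0 := ne_zero_of_nu_eq_zero hau
  have hsane : S.sig a ≠ 0 := ne_zero_of_nu_eq_zero (by rw [S.nu_sig, hau])
  have hsainv : S.nu (S.sig a)⁻¹ = 0 := nu_inv_of_nu_eq_zero (by rw [S.nu_sig, hau])
  have h2inv : S.nu (2⁻¹ : E) = 0 := nu_inv_of_nu_eq_zero S.nu_two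
  have h2 : (2 : E) ≠ 0 := ne_zero_of_nu_eq_zero S.nu_two
  -- the trace-zero part of `b / a`
  obtain ⟨y, hy⟩ : ∃ y, y = 2⁻¹ * (b * a⁻¹ - S.sig b * (S.sig a)⁻¹) := ⟨_, rfl⟩
  have hsy : S.sig y = -y := by
    simp only [hy, map_mul, map_sub, map_inv₀, map_ofNat, S.sig_invol]
    ring
  have hy0 : 0 ≤ S.nu y := by
    rw [hy]
    exact le_nu_mul_left h2inv.ge (le_nu_sub
      (le_nu_mul_left hb0 (nu_inv_of_nu_eq_zero hau).ge)
      (le_nu_mul_left (le_nu_sig hb0) hsainv.ge))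
  have hβ : (n : WithTop ℤ) ≤ S.nu (a * y - b) := by
    have e : a * y - b = 2⁻¹ * (S.sig a)⁻¹ * (S.sig (d - a) * b + S.sig b * (d - a)) := by
      rw [hy, map_sub]
      field_simp
      linear_combination (-1 : E) * e01
    rw [e]
    exact le_nu_mul_left (le_nu_mul_left h2inv.ge hsainv.ge)
      (le_nu_add (le_nu_mul_right (le_nu_sig hd) hb0) (le_nu_mul_left (le_nu_sig hb0) hd))
  have hβw : (n : WithTop ℤ) ≤ S.nu ((a * y - b) * w - (c - b * w)) :=
    le_nu_sub (le_nu_mul_right hβ hnw0) hc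
  have hay0 : 0 ≤ S.nu (a * y) := le_nu_mul_left ha0 hy0
  -- the norm defect of `a`, corrected by a square root
  obtain ⟨r, hsr, hrr, hrn⟩ := exists_sq_eq (S := S) hn
    (D := a * S.sig a * (1 - y * y * w))
    (by simp only [map_mul, map_sub, map_one, S.sig_invol, hsy, hsw]; ring) (by
      have e : a * S.sig a * (1 - y * y * w) - 1 = S.sig (a * y - b) * (a * y * w) +
          S.sig b * ((a * y - b) * w - (c - b * w)) - a * S.sig (d - a) := by
        simp only [map_sub, map_mul, hsy]
        linear_combination e00
      rw [e]
      exact le_nu_sub (le_nu_add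
        (le_nu_mul_right (le_nu_sig hβ) (le_nu_mul_left hay0 hnw0))
        (le_nu_mul_left (le_nu_sig hb0) hβw)) (le_nu_mul_left ha0 (le_nu_sig hd)))
  have hru : S.nu r = 0 := nu_eq_zero_of_one_le_nu_sub_one (hn1.trans hrn)
  have hrne : r ≠ 0 := ne_zero_of_nu_eq_zero hru
  have hrinv : 0 ≤ S.nu r⁻¹ := (nu_inv_of_nu_eq_zero hru).ge
  obtain ⟨a', ha'⟩ : ∃ a', a' = a * r⁻¹ := ⟨_, rfl⟩
  have ha'0 : 0 ≤ S.nu a' := by rw [ha']; exact le_nu_mul_left ha0 hrinv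
  have haa' : (n : WithTop ℤ) ≤ S.nu (a - a') := by
    have e : a - a' = a * r⁻¹ * (r - 1) := by rw [ha']; field_simp
    rw [e]
    exact le_nu_mul_left (le_nu_mul_left ha0 hrinv) hrn
  have hbb' : (n : WithTop ℤ) ≤ S.nu (b - a' * y) := by
    have e : b - a' * y = (a - a') * y - (a * y - b) := by ring
    rw [e]
    exact le_nu_sub (le_nu_mul_right haa' hy0) hβ
  have hnorm : a' * S.sig a' * (1 - y * y * w) = 1 := by
    rw [ha', map_mul, map_inv₀, hsr]
    field_simp
    linear_combination -hrr
  have htint (i j : Fin 2) : 0 ≤ S.nu (!![a', a' * y; a' * y * w, a'] i j) := by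
    have h1 := le_nu_mul_left ha'0 hy0
    have h3 := le_nu_mul_right h1 hnw0
    fin_cases i <;> fin_cases j <;> assumption
  refine ⟨!![a', a' * y; a' * y * w, a'], ⟨mem_Kset_of_integral ?_ htint, rfl, rfl⟩, ?_⟩
  · rw [mem_Gset_iff, herm_apply]
    ext i j
    fin_cases i <;> fin_cases j <;>
      simp [Matrix.mul_apply, Fin.sum_univ_two, hsy, hsw] <;>
      first | linear_combination hnorm | ring
  · intro i j
    fin_cases i <;> fin_cases j
    · change _ ≤ S.nu (k 0 0 - a')
      rwa [← ha]
    · change _ ≤ S.nu (k 0 1 - a' * y)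
      rwa [← hb]
    · change _ ≤ S.nu (k 1 0 - a' * y * w)
      have e : k 1 0 - a' * y * w = (c - b * w) + (b - a' * y) * w := by rw [hc']; ring
      rw [e]
      exact le_nu_add hc (le_nu_mul_right hbb' hnw0)
    · change _ ≤ S.nu (k 1 1 - a')
      have e : k 1 1 - a' = (d - a) + (a - a') := by rw [hd']; ring
      rw [e]
      exact le_nu_add hd haa'

/-- for `X = [[0, u√ε],[v√ε, 0]]` with `ν(u) = 0 < ν(v)`, and `s > 0`,
`k⁻¹ X k ∈ X + 𝔨_s` if and only if `k = c·g` with `c ∈ T(X)` and `g ∈ K_{⌈s⌉}`. -/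
theorem stmt13 (S : USetting E) (s : ℝ) (hs : 0 < s) (u v : E)
    (hu : S.sig u = u) (hv : S.sig v = v) (hnu : S.nu u = 0) (hnv : 0 < S.nu v)
    (k : Mat E) (hk : k ∈ Kset S) :
    k⁻¹ * Xzuv S 0 u v * k - Xzuv S 0 u v ∈ kfrakC S (Int.ceil s) ↔
      ∃ c ∈ TXset S u v, ∃ g ∈ Kfil S (Int.ceil s), k = c * g := by
  have hn : 1 ≤ ⌈s⌉ := Int.one_le_ceil_iff.2 hs
  generalize ⌈s⌉ = n at *
  have hu0 : u ≠ 0 := ne_zero_of_nu_eq_zero hnu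
  constructor
  · intro h
    have hkd : IsUnit k.det := isUnit_iff_ne_zero.2 (ne_zero_of_nu_eq_zero hk.2.2)
    have hcomm := le_nu_matrix_mul hk.2.1 (le_nu_of_mem_kfrakC h)
    rw [mul_sub, mul_assoc, Matrix.mul_nonsing_inv_cancel_left k _ hkd] at hcomm
    have hus : S.nu (u * S.sqeps) = 0 := by rw [S.nu_mul, hnu, S.nu_sqeps, add_zero]
    have hd : (n : WithTop ℤ) ≤ S.nu (k 1 1 - k 0 0) := by
      refine le_nu_of_le_nu_mul_left hus ?_
      convert hcomm 0 1 using 2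
      simp [Xzuv, Matrix.mul_apply, Matrix.vecMul, dotProduct, Fin.sum_univ_two]
      ring
    have hc : (n : WithTop ℤ) ≤ S.nu (k 1 0 - k 0 1 * (u⁻¹ * v)) := by
      refine le_nu_of_le_nu_mul_left hus ?_
      convert hcomm 0 0 using 2
      simp [Xzuv, Matrix.mul_apply, Matrix.vecMul, dotProduct, Fin.sum_univ_two]
      field_simp
    obtain ⟨t, ht, htk⟩ := exists_mem_TXset_sub_le hn hu hv hnu hnv hk hd hc
    have htG := ht.1.1
    have hti := le_nu_herm ht.1.2.1
    refine ⟨t, ht, herm S t * k, ⟨mem_Kset_of_integral (mul_mem_Gset (herm_mem_Gset htG) hk.1)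
      (le_nu_matrix_mul hti hk.2.1), ?_⟩, ?_⟩
    · rw [← mem_Gset_iff.1 htG, ← mul_sub]
      exact le_nu_matrix_mul hti htk
    · rw [← mul_assoc, mul_eq_one_comm.1 (mem_Gset_iff.1 htG), one_mul]
  · rintro ⟨c, hc, g, ⟨hg, hgn⟩, rfl⟩
    refine mem_kfrakC_of_le (conj_sub_mem_gfrak hk.1 (Xzuv_mem_gfrak hu hv)) ?_
    have hcomm := commute_Xzuv_of_mem_TXset hu0 hc
    have hcG := mem_Gset_iff.1 hc.1.1
    have hgG := mem_Gset_iff.1 hg.1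
    generalize hX : Xzuv S 0 u v = X at *
    have hXi (i j : Fin 2) : 0 ≤ S.nu (X i j) := by
      subst hX
      fin_cases i <;> fin_cases j <;>
        simp [Xzuv, S.nu_zero, S.nu_mul, S.nu_sqeps, hnu, hnv.le]
    have e : (c * g)⁻¹ * X * (c * g) - X = herm S g * (X * (g - 1) - (g - 1) * X) := by
      rw [inv_eq_herm hk.1, herm_mul]
      calc herm S g * herm S c * X * (c * g) - X
          = herm S g * (herm S c * (X * c)) * g - X := by simp only [mul_assoc]
        _ = herm S g * (herm S c * c) * (X * g) - 1 * X := by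
          rw [hcomm]; simp only [mul_assoc, one_mul]
        _ = herm S g * (X * g) - herm S g * g * X := by rw [hcG, hgG, mul_one]
        _ = _ := by noncomm_ring
    rw [e]
    refine le_nu_matrix_mul (le_nu_herm hg.2.1) fun i j => ?_
    refine le_nu_sub (le_nu_matrix_mul hXi hgn i j) ?_
    rw [Matrix.mul_apply, Fin.sum_univ_two]
    exact le_nu_add (le_nu_mul_right (hgn _ _) (hXi _ _)) (le_nu_mul_right (hgn _ _) (hXi _ _))
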